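/- arXiv:1504.06683 — 2 statements merged into one kernel-verified Lean document; each statement's English description precedes it below -/
import Mathlib

section
/- Let x ∈ 𝓝 and v ∈ 𝓝^⊥. If the positive part of x·v = Σ_{t=0}^T x_t·v_t is integrable, then x·v is integrable and E(x·v) = 0. -/
open MeasureTheory

/-- The sum `x·v = Σ_t x_t·v_t`. -/
def dotN {T : ℕ} (nt : Fin (T+1) → ℕ) (a b : (t : Fin (T+1)) → Fin (nt t) → ℝ) : ℝ :=
  ∑ t, ∑ i, a t i * b t i

theorem aux_limit {Ω : Type} [MeasurableSpace Ω] (P : Measure Ω)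
    (f : Ω → ℝ) (A : ℕ → Set Ω) (hA : AECover P Filter.atTop A)
    (hpos : Integrable (fun ω => max (f ω) 0) P)
    (hi : ∀ n, IntegrableOn f (A n) P) (h0 : ∀ n, ∫ ω in A n, f ω ∂P = 0) :
    Integrable f P ∧ ∫ ω, f ω ∂P = 0 := by
  have hf : Integrable f P := by
    refine hA.integrable_of_integral_norm_bounded (2 * ∫ ω, max (f ω) 0 ∂P) hi
      (Filter.Eventually.of_forall fun n => ?_)
    have e : ∀ ω, ‖f ω‖ = 2 * max (f ω) 0 - f ω := by
      intro ω
      rw [Real.norm_eq_abs]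
      rcases le_total (f ω) 0 with h | h
      · rw [max_eq_right h, abs_of_nonpos h]; ring
      · rw [max_eq_left h, abs_of_nonneg h]; ring
    simp_rw [e]
    rw [integral_sub (hpos.integrableOn.const_mul 2) (hi n), h0, integral_const_mul, sub_zero]
    have := setIntegral_le_integral (s := A n) hpos
      (Filter.Eventually.of_forall fun ω => le_max_right _ _)
    linarith
  refine ⟨hf, ?_⟩
  have := hA.integral_tendsto_of_countably_generated hf
  simp_rw [h0] at this
  exact tendsto_nhds_unique this tendsto_const_nhds

theorem aux_dot_int {Ω : Type} [mΩ : MeasurableSpace Ω] (P : Measure Ω)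
    {T : ℕ} (nt : Fin (T+1) → ℕ)
    (x : Ω → (t : Fin (T+1)) → Fin (nt t) → ℝ) (hx : ∀ t, Measurable (fun ω => x ω t))
    (v : Ω → (t : Fin (T+1)) → Fin (nt t) → ℝ) (hv_int : Integrable v P)
    (M : ℝ) (hM : ∀ ω, ‖x ω‖ ≤ M) :
    Integrable (fun ω => dotN nt (x ω) (v ω)) P := by
  unfold dotN
  refine integrable_finsetSum _ fun t _ => integrable_finsetSum _ fun i _ => ?_
  have hvi : Integrable (fun ω => v ω t i) P := (hv_int.eval t).eval i
  refine hvi.bdd_mul (c := M) ?_ ?_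
  · exact ((measurable_pi_apply i).comp (hx t)).aestronglyMeasurable
  · exact Filter.Eventually.of_forall fun ω =>
      ((norm_le_pi_norm (x ω t) i).trans (norm_le_pi_norm (x ω) t)).trans (hM ω)

/-- if `x ∈ 𝓝`, `v ∈ 𝓝^⊥` and the positive part of `x·v` is integrable,
then `x·v` is integrable and `E(x·v) = 0`. -/
theorem stmt_0
    {Ω : Type} [mΩ : MeasurableSpace Ω] (P : Measure Ω) [IsProbabilityMeasure P]
    (T : ℕ) (ℱ : Fin (T+1) → MeasurableSpace Ω)
    (hℱ_le : ∀ t, ℱ t ≤ mΩ) (hℱ_mono : Monotone ℱ)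
    (nt : Fin (T+1) → ℕ)
    -- `x ∈ 𝓝` : an adapted strategy
    (x : Ω → (t : Fin (T+1)) → Fin (nt t) → ℝ)
    (hx : ∀ t, Measurable[ℱ t] (fun ω => x ω t))
    -- `v ∈ 𝓝^⊥`
    (v : Ω → (t : Fin (T+1)) → Fin (nt t) → ℝ)
    (hv_meas : Measurable v)
    (hv_int : Integrable v P)
    (hv_perp : ∀ x' : Ω → (t : Fin (T+1)) → Fin (nt t) → ℝ,
      (∀ t, Measurable[ℱ t] (fun ω => x' ω t)) →
      (∃ M : ℝ, ∀ᵐ ω ∂P, ‖x' ω‖ ≤ M) →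
      ∫ ω, dotN nt (x' ω) (v ω) ∂P = 0)
    -- the positive part of `x·v` is integrable
    (hpos : Integrable (fun ω => max (dotN nt (x ω) (v ω)) 0) P) :
    Integrable (fun ω => dotN nt (x ω) (v ω)) P ∧
      ∫ ω, dotN nt (x ω) (v ω) ∂P = 0 := by
  classical
  have key : ∀ k : ℕ, ∀ x : Ω → (t : Fin (T+1)) → Fin (nt t) → ℝ,
      (∀ t, Measurable[ℱ t] (fun ω => x ω t)) →
      (∀ t : Fin (T+1), t.val + k < T + 1 → ∀ ω, x ω t = 0) →
      Integrable (fun ω => max (dotN nt (x ω) (v ω)) 0) P →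
      Integrable (fun ω => dotN nt (x ω) (v ω)) P ∧
        ∫ ω, dotN nt (x ω) (v ω) ∂P = 0 := by
    intro k
    induction k with
    | zero =>
      intro x hx h0 hpos
      have : ∀ ω, dotN nt (x ω) (v ω) = 0 := by
        intro ω
        unfold dotN
        refine Finset.sum_eq_zero fun t _ => Finset.sum_eq_zero fun i _ => ?_
        rw [h0 t (by omega) ω]; simp
      simp [this]
    | succ k ih =>
      intro x hx h0 hpos
      by_cases hk : T < k
      · exact ih x hx (fun t ht => by omega) hpos
      obtain ⟨s, hs⟩ : ∃ s : Fin (T+1), s.val = T - k := ⟨⟨T - k, by omega⟩, rfl⟩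
      let A : ℕ → Set Ω := fun n => {ω | ‖x ω s‖ ≤ n}
      have hAs : ∀ n, MeasurableSet[ℱ s] (A n) := fun n =>
        hx s (measurableSet_le measurable_norm measurable_const :
          MeasurableSet {y : Fin (nt s) → ℝ | ‖y‖ ≤ (n : ℝ)})
      have hAm : ∀ n, MeasurableSet (A n) := fun n => hℱ_le s _ (hAs n)
      have hcov : AECover P Filter.atTop A := by
        refine ⟨Filter.Eventually.of_forall fun ω => ?_, hAm⟩
        obtain ⟨N, hN⟩ := exists_nat_ge ‖x ω s‖
        filter_upwards [Filter.eventually_ge_atTop N] with n hn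
        exact hN.trans (by exact_mod_cast hn)
      have main : ∀ n, IntegrableOn (fun ω => dotN nt (x ω) (v ω)) (A n) P ∧
          ∫ ω in A n, dotN nt (x ω) (v ω) ∂P = 0 := by
        intro n
        let y : Ω → (t : Fin (T+1)) → Fin (nt t) → ℝ := fun ω t =>
          if t ≤ s then 0 else (A n).indicator (fun ω => x ω t) ω
        let z : Ω → (t : Fin (T+1)) → Fin (nt t) → ℝ := fun ω t =>
          if t = s then (A n).indicator (fun ω => x ω t) ω else 0
        have hy : ∀ t, Measurable[ℱ t] (fun ω => y ω t) := by
          intro t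
          by_cases h : t ≤ s
          · simp only [y, h, if_true]; exact @measurable_const _ _ _ (ℱ t) _
          · simp only [y, h, if_false]
            have hle : ℱ s ≤ ℱ t := hℱ_mono (not_le.mp h).le
            exact Measurable.indicator (hx t) (hle (A n) (hAs n))
        have hz : ∀ t, Measurable[ℱ t] (fun ω => z ω t) := by
          intro t
          by_cases h : t = s
          · subst h
            simp only [z, if_true]
            exact Measurable.indicator (hx t) (hAs n)
          · simp only [z, h, if_false]; exact @measurable_const _ _ _ (ℱ t) _
        have hzb : ∀ ω, ‖z ω‖ ≤ n := by
          intro ω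
          refine (pi_norm_le_iff_of_nonneg (Nat.cast_nonneg n)).2 fun t => ?_
          by_cases h : t = s
          · by_cases hω : ω ∈ A n
            · subst h
              simp only [z, if_true, Set.indicator_of_mem hω]
              exact hω
            · simp [z, hω]
          · simp [z, h]
        have hzi : Integrable (fun ω => dotN nt (z ω) (v ω)) P :=
          aux_dot_int P nt z (fun t => (hz t).mono (hℱ_le t) le_rfl) v hv_int n hzb
        have hz0 := hv_perp z hz ⟨n, Filter.Eventually.of_forall hzb⟩
        have hsum : ∀ ω, (A n).indicator (fun ω => dotN nt (x ω) (v ω)) ω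
            = dotN nt (y ω) (v ω) + dotN nt (z ω) (v ω) := by
          intro ω
          unfold dotN
          rw [← Finset.sum_add_distrib]
          by_cases hω : ω ∈ A n
          · rw [Set.indicator_of_mem hω]
            refine Finset.sum_congr rfl fun t _ => ?_
            rw [← Finset.sum_add_distrib]
            refine Finset.sum_congr rfl fun i _ => ?_
            rcases lt_trichotomy t s with h | h | h
            · have := h0 t (by have : t.val < s.val := h
                               omega) ω
              simp [y, z, h.le, h.ne, this]
            · simp [y, z, h, hω]
            · simp [y, z, h.not_ge, h.ne', hω]
          · rw [Set.indicator_of_notMem hω]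
            simp [y, z, hω]
        have hdm : ∀ w : Ω → (t : Fin (T+1)) → Fin (nt t) → ℝ,
            (∀ t, Measurable[ℱ t] (fun ω => w ω t)) →
            Measurable (fun ω => dotN nt (w ω) (v ω)) := by
          intro w hw
          unfold dotN
          refine Finset.measurable_fun_sum _ fun t _ => Finset.measurable_fun_sum _ fun i _ => ?_
          have h1 : Measurable (fun ω => w ω t i) :=
            (measurable_pi_apply i).comp ((hw t).mono (hℱ_le t) le_rfl)
          have h2 : Measurable (fun ω => v ω t i) :=
            (measurable_pi_apply i).comp ((measurable_pi_apply t).comp hv_meas)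
          exact h1.mul h2
        have hypos : Integrable (fun ω => max (dotN nt (y ω) (v ω)) 0) P := by
          refine (hpos.add hzi.norm).mono'
            ((hdm y hy).max measurable_const).aestronglyMeasurable
            (Filter.Eventually.of_forall fun ω => ?_)
          have h1 := hsum ω
          have h2 : (A n).indicator (fun ω => dotN nt (x ω) (v ω)) ω
              ≤ max (dotN nt (x ω) (v ω)) 0 := by
            by_cases hω : ω ∈ A n
            · rw [Set.indicator_of_mem hω]; exact le_max_left _ _
            · rw [Set.indicator_of_notMem hω]; exact le_max_right _ _
          have h3 := neg_abs_le (dotN nt (z ω) (v ω))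
          have h4 : 0 ≤ max (dotN nt (x ω) (v ω)) 0 := le_max_right _ _
          have h5 := abs_nonneg (dotN nt (z ω) (v ω))
          simp only [Pi.add_apply, Real.norm_eq_abs]
          rw [abs_of_nonneg (le_max_right _ _)]
          exact max_le (by linarith) (by linarith)
        obtain ⟨hyi, hy0⟩ := ih y hy (fun t ht ω => by
          have : t ≤ s := by
            show t.val ≤ s.val
            omega
          simp [y, this]) hypos
        constructor
        · rw [← integrable_indicator_iff (hAm n)]
          exact (hyi.add hzi).congr (Filter.Eventually.of_forall fun ω => (hsum ω).symm)
        · rw [← integral_indicator (hAm n)]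
          simp_rw [hsum]
          rw [integral_add hyi hzi, hy0, hz0, add_zero]
      exact aux_limit P _ A hcov hpos (fun n => (main n).1) (fun n => (main n).2)
  exact key (T+1) x hx (fun t ht => by omega) hpos
end

section
/- In the stated one-period setting: (1) the Lagrangian integrand is l(x,y,ω) = yβ(ω)x when y ≥ 0 and l(x,y,ω) = −∞ when y < 0; (2) φ̃*(y) = 0 if y ≥ 0 a.s. and φ̃*(y) = +∞ otherwise; (3) for y = β⁺ one has inf_{x∈𝓝^∞} El(x,β⁺) = −∞ while φ̃*(β⁺) = 0. In particular the formula φ̃*(y) = −inf_{x∈𝓝^∞} El(x,y) fails at y = β⁺. -/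
open MeasureTheory
open scoped ENNReal

noncomputable section

/-- The positive part of an extended real number, as an extended nonnegative real. -/
def epos (a : EReal) : ℝ≥0∞ := if a = ⊤ then ⊤ else ENNReal.ofReal a.toReal

/-- Expectation of an extended-real-valued function: `+∞` unless the positive part is
integrable. -/
def EE {Ω : Type} [MeasurableSpace Ω] (P : Measure Ω) (φ : Ω → EReal) : EReal :=
  if ∫⁻ ω, epos (φ ω) ∂P = ⊤ then ⊤
  else ((∫⁻ ω, epos (φ ω) ∂P : ℝ≥0∞) : EReal) - ((∫⁻ ω, epos (-(φ ω)) ∂P : ℝ≥0∞) : EReal)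

variable {Ω : Type} [MeasurableSpace Ω]

/-- `𝓝 = L⁰(Ω,𝓕₀,P;ℝ)`: a.s. constant random variables (`𝓕₀` is the completed trivial
σ-algebra). -/
def Ncon (P : Measure Ω) : Set (Ω → ℝ) := {x | ∃ c : ℝ, x =ᵐ[P] fun _ => c}

/-- `𝓝^∞`: bounded elements of `𝓝`. -/
def NconInf (P : Measure Ω) : Set (Ω → ℝ) :=
  {x | x ∈ Ncon P ∧ ∃ M : ℝ, ∀ᵐ ω ∂P, |x ω| ≤ M}

/-- `𝓤 = L^∞`. -/
def Uinf (P : Measure Ω) : Set (Ω → ℝ) :=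
  {u | Measurable u ∧ ∃ M : ℝ, ∀ᵐ ω ∂P, |u ω| ≤ M}

/-- `𝓨 = L¹`. -/
def Yone (P : Measure Ω) : Set (Ω → ℝ) := {y | Integrable y P}

open scoped Classical in
/-- `f(x,u,ω) = δ_{ℝ₋}(β(ω)x + u)`. -/
def fEx (β : Ω → ℝ) : ℝ → ℝ → Ω → EReal :=
  fun x u ω => if β ω * x + u ≤ 0 then 0 else ⊤

/-- The Lagrangian integrand `l(x,y,ω) = inf_u {f(x,u,ω) − u y}`. -/
def lEx (β : Ω → ℝ) (x y : ℝ) (ω : Ω) : EReal :=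
  ⨅ u : ℝ, (fEx β x u ω - ((u * y : ℝ) : EReal))

/-- `El(x,y)`. -/
def ElEx (P : Measure Ω) (β : Ω → ℝ) (x y : Ω → ℝ) : EReal :=
  EE P fun ω => lEx β (x ω) (y ω) ω

/-- `φ̃(u) = inf_{x∈𝓝^∞} Ef(x,u)`. -/
def phiTilde (P : Measure Ω) (β : Ω → ℝ) (u : Ω → ℝ) : EReal :=
  ⨅ x ∈ NconInf P, EE P fun ω => fEx β (x ω) (u ω) ω

/-- `φ̃*(y) = sup_{u∈𝓤} {⟨u,y⟩ − φ̃(u)}`. -/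
def phiTildeConj (P : Measure Ω) (β : Ω → ℝ) (y : Ω → ℝ) : EReal :=
  ⨆ u ∈ Uinf P, (((∫ ω, u ω * y ω ∂P : ℝ) : EReal) - phiTilde P β u)

lemma aux_l_nonneg (β : Ω → ℝ) (x y : ℝ) (ω : Ω) (hy : 0 ≤ y) :
    lEx β x y ω = ((y * β ω * x : ℝ) : EReal) := by
  unfold lEx
  apply le_antisymm
  · refine (iInf_le _ (-(β ω * x))).trans ?_
    have : fEx β x (-(β ω * x)) ω = 0 := by simp [fEx]
    rw [this, zero_sub, ← EReal.coe_neg, EReal.coe_le_coe_iff]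
    apply le_of_eq; ring
  · refine le_iInf fun u => ?_
    by_cases h : β ω * x + u ≤ 0
    · have : fEx β x u ω = 0 := by simp [fEx, h]
      rw [this, zero_sub, ← EReal.coe_neg, EReal.coe_le_coe_iff]
      nlinarith
    · have : fEx β x u ω = ⊤ := by simp [fEx, h]
      rw [this, EReal.top_sub_coe]
      exact le_top

lemma aux_l_neg (β : Ω → ℝ) (x y : ℝ) (ω : Ω) (hy : y < 0) :
    lEx β x y ω = ⊥ := by
  unfold lEx
  rw [EReal.eq_bot_iff_forall_lt]
  intro r
  let u : ℝ := min (-(β ω * x)) ((1 - r) / y)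
  refine (iInf_le _ u).trans_lt ?_
  have hu1 : u ≤ -(β ω * x) := min_le_left _ _
  have hu2 : u ≤ (1 - r) / y := min_le_right _ _
  have : fEx β x u ω = 0 := by
    simp only [fEx]; rw [if_pos (by linarith)]
  rw [this, zero_sub, ← EReal.coe_neg, EReal.coe_lt_coe_iff]
  rw [le_div_iff_of_neg hy] at hu2
  linarith

lemma aux_EE_zero (P : Measure Ω) (φ : Ω → EReal) (h : ∀ᵐ ω ∂P, φ ω = 0) : EE P φ = 0 := by
  have h1 : ∫⁻ ω, epos (φ ω) ∂P = 0 := by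
    rw [lintegral_congr_ae (g := fun _ => 0) (by filter_upwards [h] with ω hω; simp [hω, epos])]
    simp
  have h2 : ∫⁻ ω, epos (-(φ ω)) ∂P = 0 := by
    rw [lintegral_congr_ae (g := fun _ => 0) (by filter_upwards [h] with ω hω; simp [hω, epos])]
    simp
  simp [EE, h1, h2]

lemma aux_EE_f (P : Measure Ω) (β u x : Ω → ℝ) (c : ℝ) (hβ : Measurable β) (hu : Measurable u)
    (hx : x =ᵐ[P] fun _ => c) (h : ¬ ∀ᵐ ω ∂P, β ω * c + u ω ≤ 0) :
    EE P (fun ω => fEx β (x ω) (u ω) ω) = ⊤ := by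
  have h1 : ∫⁻ ω, epos (fEx β (x ω) (u ω) ω) ∂P = ⊤ := by
    by_contra hne
    apply h
    have hA : MeasurableSet {ω | β ω * c + u ω ≤ 0} :=
      measurableSet_le (by fun_prop) measurable_const
    have e : ∫⁻ ω, epos (fEx β (x ω) (u ω) ω) ∂P =
        ∫⁻ ω, ({ω | β ω * c + u ω ≤ 0}ᶜ.indicator (fun _ => (⊤ : ℝ≥0∞))) ω ∂P := by
      apply lintegral_congr_ae
      filter_upwards [hx] with ω hω
      by_cases hh : β ω * c + u ω ≤ 0 <;> simp [fEx, hω, hh, epos]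
    rw [e] at hne
    have := ae_lt_top (measurable_const.indicator hA.compl) hne
    filter_upwards [this] with ω hω
    by_contra hh
    simp [hh] at hω
  simp [EE, h1]

lemma aux_phi_zero (P : Measure Ω) (β u : Ω → ℝ) (hu : ∀ᵐ ω ∂P, u ω ≤ 0) :
    phiTilde P β u ≤ 0 := by
  unfold phiTilde
  refine (iInf₂_le (fun _ => 0) ⟨⟨0, Filter.EventuallyEq.rfl⟩, 0, by simp⟩).trans ?_
  rw [aux_EE_zero]
  filter_upwards [hu] with ω hω
  simp [fEx, hω]

lemma aux_phi_nonneg (P : Measure Ω) (β u : Ω → ℝ) (hβ : Measurable β) (hu : Measurable u) :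
    0 ≤ phiTilde P β u := by
  unfold phiTilde
  refine le_iInf₂ fun x hx => ?_
  obtain ⟨⟨c, hc⟩, -⟩ := hx
  by_cases h : ∀ᵐ ω ∂P, β ω * c + u ω ≤ 0
  · rw [aux_EE_zero]
    filter_upwards [h, hc] with ω hω h2
    simp [fEx, hω, h2]
  · rw [aux_EE_f P β u x c hβ hu hc h]; exact le_top

lemma aux_phi_top (P : Measure Ω) (β u : Ω → ℝ) (hβ : Measurable β) (hu : u ∈ Uinf P)
    (hβp_unbdd : ¬ ∃ M : ℝ, ∀ᵐ ω ∂P, max (β ω) 0 ≤ M)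
    (hβm_unbdd : ¬ ∃ M : ℝ, ∀ᵐ ω ∂P, max (-β ω) 0 ≤ M)
    (h : ¬ ∀ᵐ ω ∂P, u ω ≤ 0) : phiTilde P β u = ⊤ := by
  unfold phiTilde
  obtain ⟨hum, M, hM⟩ := hu
  simp only [iInf_eq_top]
  intro x hx
  obtain ⟨⟨c, hc⟩, -⟩ := hx
  apply aux_EE_f P β u x c hβ hum hc
  intro hh
  rcases lt_trichotomy c 0 with h0 | h0 | h0
  · apply hβm_unbdd
    refine ⟨max (M / (-c)) 0, ?_⟩
    filter_upwards [hh, hM] with ω h1 h2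
    apply max_le_max _ le_rfl
    rw [le_div_iff₀ (by linarith)]
    have := neg_le_of_abs_le h2
    nlinarith
  · apply h
    filter_upwards [hh] with ω h1
    simpa [h0] using h1
  · apply hβp_unbdd
    refine ⟨max (M / c) 0, ?_⟩
    filter_upwards [hh, hM] with ω h1 h2
    apply max_le_max _ le_rfl
    rw [le_div_iff₀ h0]
    have := neg_le_of_abs_le h2
    nlinarith

lemma aux_conj_zero (P : Measure Ω) (β y : Ω → ℝ) (hβ : Measurable β)
    (hβp_unbdd : ¬ ∃ M : ℝ, ∀ᵐ ω ∂P, max (β ω) 0 ≤ M)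
    (hβm_unbdd : ¬ ∃ M : ℝ, ∀ᵐ ω ∂P, max (-β ω) 0 ≤ M)
    (hy : ∀ᵐ ω ∂P, 0 ≤ y ω) : phiTildeConj P β y = 0 := by
  unfold phiTildeConj
  apply le_antisymm
  · refine iSup₂_le fun u hu => ?_
    by_cases h : ∀ᵐ ω ∂P, u ω ≤ 0
    · have h1 : phiTilde P β u = 0 :=
        le_antisymm (aux_phi_zero P β u h) (aux_phi_nonneg P β u hβ hu.1)
      rw [h1, sub_zero]
      norm_cast
      apply integral_nonpos_of_ae
      filter_upwards [h, hy] with ω a b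
      exact mul_nonpos_of_nonpos_of_nonneg a b
    · rw [aux_phi_top P β u hβ hu hβp_unbdd hβm_unbdd h, EReal.sub_top]
      exact bot_le
  · have h0 : (fun _ => 0 : Ω → ℝ) ∈ Uinf P := ⟨measurable_const, 0, by simp⟩
    refine le_trans ?_ (le_iSup₂ (fun _ => 0 : Ω → ℝ) h0)
    have h1 : phiTilde P β (fun _ => 0) = 0 :=
      le_antisymm (aux_phi_zero P β _ (by simp)) (aux_phi_nonneg P β _ hβ measurable_const)
    simp [h1]

lemma aux_conj_top (P : Measure Ω) (β y : Ω → ℝ) (hβ : Measurable β) (hyi : Integrable y P)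
    (hy : ¬ ∀ᵐ ω ∂P, 0 ≤ y ω) : phiTildeConj P β y = ⊤ := by
  unfold phiTildeConj
  let z := hyi.1.mk y
  have hz : Measurable z := hyi.1.stronglyMeasurable_mk.measurable
  have hyz : y =ᵐ[P] z := hyi.1.ae_eq_mk
  let A : Set Ω := {ω | z ω < 0}
  have hA : MeasurableSet A := measurableSet_lt hz measurable_const
  have hpos : 0 < ∫ ω, max (-y ω) 0 ∂P := by
    rw [lt_iff_le_and_ne]
    refine ⟨integral_nonneg fun ω => le_max_right _ _, fun h => hy ?_⟩
    have := (integral_eq_zero_iff_of_nonneg (fun ω => le_max_right _ _)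
      (hyi.neg.pos_part)).1 h.symm
    filter_upwards [this] with ω hω
    have h3 : max (-y ω) 0 = 0 := hω
    have := le_max_left (-y ω) 0
    linarith
  set I := ∫ ω, max (-y ω) 0 ∂P with hI
  rw [EReal.eq_top_iff_forall_lt]
  intro r
  let k : ℝ := max 0 ((r + 1) / I)
  have hk : 0 ≤ k := le_max_left _ _
  let u : Ω → ℝ := A.indicator fun _ => -k
  have hum : Measurable u := measurable_const.indicator hA
  have hu : u ∈ Uinf P := by
    refine ⟨hum, k, Filter.Eventually.of_forall fun ω => ?_⟩
    by_cases h : ω ∈ A <;> simp [u, h, abs_of_nonneg hk, hk]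
  refine lt_of_lt_of_le ?_ (le_iSup₂ u hu)
  have hphi : phiTilde P β u = 0 := by
    refine le_antisymm (aux_phi_zero P β u (Filter.Eventually.of_forall fun ω => ?_))
      (aux_phi_nonneg P β u hβ hum)
    by_cases h : ω ∈ A <;> simp [u, h, hk]
  have hint : ∫ ω, u ω * y ω ∂P = k * I := by
    rw [hI, ← integral_const_mul]
    apply integral_congr_ae
    filter_upwards [hyz] with ω hω
    by_cases h : z ω < 0
    · have : ω ∈ A := h
      simp only [u, Set.indicator_of_mem this, hω]
      rw [max_eq_left (by linarith)]; ring
    · have : ω ∉ A := h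
      simp only [u, Set.indicator_of_notMem this, hω]
      rw [max_eq_right (by linarith)]; ring
  rw [hphi, sub_zero, hint, EReal.coe_lt_coe_iff]
  have : (r + 1) / I ≤ k := le_max_right _ _
  rw [div_le_iff₀ hpos] at this
  linarith

lemma aux_inf_bot (P : Measure Ω) [IsProbabilityMeasure P]
    (β : Ω → ℝ) (hβ : Measurable β) (hβ_L2 : MemLp β 2 P)
    (hβp_unbdd : ¬ ∃ M : ℝ, ∀ᵐ ω ∂P, max (β ω) 0 ≤ M) :
    (⨅ x ∈ NconInf P, ElEx P β x (fun ω => max (β ω) 0)) = ⊥ := by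
  have hint : Integrable (fun ω => max (β ω) 0 * β ω) P := by
    refine hβ_L2.integrable_sq.mono (by fun_prop) (Filter.Eventually.of_forall fun ω => ?_)
    rcases le_total (β ω) 0 with h | h
    · simp [h, sq_nonneg]
    · simp [h, sq]
  have hnn : ∀ ω, 0 ≤ max (β ω) 0 * β ω := by
    intro ω
    rcases le_total (β ω) 0 with h | h
    · simp [h]
    · simp [h, mul_self_nonneg]
  have hpos : 0 < ∫ ω, max (β ω) 0 * β ω ∂P := by
    rw [lt_iff_le_and_ne]
    refine ⟨integral_nonneg hnn, fun h => hβp_unbdd ⟨0, ?_⟩⟩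
    have := (integral_eq_zero_iff_of_nonneg hnn hint).1 h.symm
    filter_upwards [this] with ω hω
    have h3 : max (β ω) 0 * β ω = 0 := hω
    rcases mul_eq_zero.1 h3 with h4 | h4
    · exact h4.le
    · simp [h4]
  set I := ∫ ω, max (β ω) 0 * β ω ∂P with hI
  rw [EReal.eq_bot_iff_forall_lt]
  intro r
  let k : ℝ := max 0 ((1 - r) / I)
  have hk : 0 ≤ k := le_max_left _ _
  refine lt_of_le_of_lt (iInf₂_le (fun _ => -k)
    ⟨⟨-k, Filter.EventuallyEq.rfl⟩, k, by simp [abs_of_nonneg hk]⟩) ?_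
  have e : ElEx P β (fun _ => -k) (fun ω => max (β ω) 0) = ((-(k * I) : ℝ) : EReal) := by
    unfold ElEx EE
    have hl : ∀ ω, lEx β (-k) (max (β ω) 0) ω = ((-(k * (max (β ω) 0 * β ω)) : ℝ) : EReal) := by
      intro ω
      rw [aux_l_nonneg β _ _ ω (le_max_right _ _)]
      congr 1; ring
    simp only [hl, ← EReal.coe_neg, neg_neg]
    have h1 : ∀ ω, epos ((-(k * (max (β ω) 0 * β ω)) : ℝ) : EReal) = 0 := by
      intro ω
      have := mul_nonneg hk (hnn ω)
      simp only [epos, EReal.coe_ne_top, if_false, EReal.toReal_coe]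
      exact ENNReal.ofReal_of_nonpos (by linarith)
    have h2 : ∀ ω, epos ((k * (max (β ω) 0 * β ω) : ℝ) : EReal)
        = ENNReal.ofReal (k * (max (β ω) 0 * β ω)) := by
      intro ω
      simp only [epos, EReal.coe_ne_top, if_false, EReal.toReal_coe]
    simp only [h1, h2]
    rw [← ofReal_integral_eq_lintegral_ofReal (hint.const_mul k)
      (Filter.Eventually.of_forall fun ω => mul_nonneg hk (hnn ω)), integral_const_mul, ← hI]
    have : 0 ≤ k * I := mul_nonneg hk hpos.le
    simp [EReal.coe_ennreal_ofReal, max_eq_left this]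
  rw [e, EReal.coe_lt_coe_iff]
  have : (1 - r) / I ≤ k := le_max_right _ _
  rw [div_le_iff₀ hpos] at this
  linarith

/-- the one-period counterexample where the dual representation
`φ̃*(y) = −inf_{x∈𝓝^∞} El(x,y)` fails at `y = β⁺`. -/
theorem stmt_5 (P : Measure Ω) [IsProbabilityMeasure P]
    (β : Ω → ℝ) (hβ_meas : Measurable β) (hβ_L2 : MemLp β 2 P)
    (hβp_unbdd : ¬ ∃ M : ℝ, ∀ᵐ ω ∂P, max (β ω) 0 ≤ M)
    (hβm_unbdd : ¬ ∃ M : ℝ, ∀ᵐ ω ∂P, max (-β ω) 0 ≤ M) :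
    -- (1) the Lagrangian integrand
    (∀ (x yv : ℝ) (ω : Ω),
      (0 ≤ yv → lEx β x yv ω = ((yv * β ω * x : ℝ) : EReal)) ∧
      (yv < 0 → lEx β x yv ω = ⊥)) ∧
    -- (2) `φ̃* = δ_{L¹₊}`
    (∀ y ∈ Yone P,
      ((∀ᵐ ω ∂P, 0 ≤ y ω) → phiTildeConj P β y = 0) ∧
      ((¬ ∀ᵐ ω ∂P, 0 ≤ y ω) → phiTildeConj P β y = ⊤)) ∧
    -- (3) the failure at `y = β⁺`
    ((⨅ x ∈ NconInf P, ElEx P β x (fun ω => max (β ω) 0)) = ⊥) ∧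
    (phiTildeConj P β (fun ω => max (β ω) 0) = 0) ∧
    phiTildeConj P β (fun ω => max (β ω) 0) ≠
      - ⨅ x ∈ NconInf P, ElEx P β x (fun ω => max (β ω) 0) := by
  have h0 := aux_conj_zero P β (fun ω => max (β ω) 0) hβ_meas hβp_unbdd hβm_unbdd
    (Filter.Eventually.of_forall fun ω => le_max_right _ _)
  have hb := aux_inf_bot P β hβ_meas hβ_L2 hβp_unbdd
  refine ⟨fun x y ω => ⟨aux_l_nonneg β x y ω, aux_l_neg β x y ω⟩, fun y hy =>
    ⟨aux_conj_zero P β y hβ_meas hβp_unbdd hβm_unbdd, aux_conj_top P β y hβ_meas hy⟩, hb, h0, ?_⟩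
  rw [hb, h0]
  simp


end
end
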